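/- arXiv:1912.12312 — 2 statements merged into one kernel-verified Lean document; each statement's English description precedes it below -/
import Mathlib

section
/- (Lemma 5.5.) Let 1 ≤ c ≤ g. If w ∈ ᶜW and w ∉ ᶜ⁻¹W, then supp(w) = {t_{g−c+1}, t_{g−c+2}, …, t_g}. -/
/-- The entries of the Coxeter matrix of type `C_g`; the index `a : Fin g` (0-based)
corresponds to the simple reflection `t_{a+1}` of the paper:  `m(t_i, t_j) = 2` if
`|i−j| ≥ 2`, `m(t_i, t_{i+1}) = 3` for `1 ≤ i ≤ g−2`, and `m(t_{g−1}, t_g) = 4`. -/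
def cFinEntry (g a b : ℕ) : ℕ :=
  if a = b then 1
  else if a + 1 < b ∨ b + 1 < a then 2
  else if (a = g - 2 ∧ b = g - 1) ∨ (b = g - 2 ∧ a = g - 1) then 4
  else 3

/-- The Coxeter matrix of type `C_g` (the Weyl group of `Sp_{2g}`), on the index set
`Fin g` (the index `a` corresponds to the simple reflection `t_{a+1}` of the paper). -/
def CFinMatrix (g : ℕ) : CoxeterMatrix (Fin g) where
  M := Matrix.of fun a b => cFinEntry g (a : ℕ) (b : ℕ)
  isSymm := by
    ext a b
    simp only [Matrix.transpose_apply, Matrix.of_apply, cFinEntry]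
    split_ifs <;> omega
  diagonal := by
    intro a
    simp [cFinEntry]
  off_diagonal := by
    intro a b hab
    have h : (a : ℕ) ≠ (b : ℕ) := fun h => hab (Fin.ext h)
    simp only [Matrix.of_apply, cFinEntry]
    split_ifs <;> omega

/-- The support of an element `w` of a Coxeter group: the set of indices of the simple
reflections occurring in some (equivalently, any) reduced expression of `w`. -/
def supp {B W : Type*} [Group W] {M : CoxeterMatrix B} (cs : CoxeterSystem M W) (w : W) :
    Set B :=
  {i | ∃ ω : List B, cs.IsReduced ω ∧ cs.wordProd ω = w ∧ i ∈ ω}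

/-- The standard parabolic subgroup `W_c = ⟨t_{g−c+1}, …, t_g⟩` (for `0 ≤ c ≤ g`);
in the 0-based indexing of `Fin g` it is generated by the simple reflections with index
`≥ g − c`.  In particular `W_0` is trivial. -/
def Wc (g : ℕ) {W : Type*} [Group W] (cs : CoxeterSystem (CFinMatrix g) W) (c : ℕ) :
    Subgroup W :=
  Subgroup.closure (cs.simple '' {j : Fin g | g - c ≤ (j : ℕ)})

/-- The set `ᶜW = {w ∈ W_c : ℓ(t_j w) > ℓ(w) for all g−c+1 ≤ j ≤ g−1}` of minimal-length
representatives of the cosets `⟨t_{g−c+1},…,t_{g−1}⟩\W_c` (0-based indexing: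
`j` ranges over the indices with `g − c ≤ j ≤ g − 2`). -/
def cW (g : ℕ) {W : Type*} [Group W] (cs : CoxeterSystem (CFinMatrix g) W) (c : ℕ) :
    Set W :=
  {w | w ∈ Wc g cs c ∧
    ∀ j : Fin g, g - c ≤ (j : ℕ) → (j : ℕ) < g - 1 →
      cs.length w < cs.length (cs.simple j * w)}

section ReflectionCocycle

open CoxeterSystem

variable {B W : Type*} [Group W] {M : CoxeterMatrix B} (cs : CoxeterSystem M W)

open Classical in
/-- The map `(x, ε) ↦ (s_i x s_i, ε + [x = s_i])` attached to a simple reflection. -/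
noncomputable def reflectionStep (i : B) : Function.End (W × ZMod 2) := fun p =>
  (cs.simple i * p.1 * cs.simple i, p.2 + if p.1 = cs.simple i then 1 else 0)

theorem simple_mul_rotation_pow (i i' : B) (n : ℕ) :
    cs.simple i' * (cs.simple i * cs.simple i') ^ n =
      ((cs.simple i * cs.simple i') ^ n)⁻¹ * cs.simple i' := by
  have h : SemiconjBy (cs.simple i') (cs.simple i * cs.simple i')
      (cs.simple i * cs.simple i')⁻¹ := by
    simp [SemiconjBy, mul_assoc]
  have h' := (h.pow_right n).eq
  rwa [inv_pow] at h'

open Classical in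
theorem reflectionStep_mul_pow (i i' : B) (n : ℕ) (p : W × ZMod 2) :
    ((reflectionStep cs i * reflectionStep cs i') ^ n : Function.End (W × ZMod 2)) p =
      ((cs.simple i * cs.simple i') ^ n * p.1 * ((cs.simple i * cs.simple i') ^ n)⁻¹,
        p.2 + ∑ k ∈ Finset.range (2 * n),
          if p.1 = ((cs.simple i * cs.simple i') ^ k)⁻¹ * cs.simple i' then 1 else 0) := by
  induction n with
  | zero => simp; rfl
  | succ n ih =>
    rw [pow_succ']
    change reflectionStep cs i (reflectionStep cs i' (_)) = _
    rw [ih]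
    have hq := simple_mul_rotation_pow cs i i' n
    set q := cs.simple i * cs.simple i' with hq_def
    have h1 : q ^ n * p.1 * (q ^ n)⁻¹ = cs.simple i' ↔
        p.1 = (q ^ (2 * n))⁻¹ * cs.simple i' := by
      rw [mul_inv_eq_iff_eq_mul, hq, ← eq_inv_mul_iff_mul_eq, two_mul, pow_add, mul_inv_rev,
        mul_assoc]
    have h2 : cs.simple i' * (q ^ n * p.1 * (q ^ n)⁻¹) * cs.simple i' = cs.simple i ↔
        p.1 = (q ^ (2 * n + 1))⁻¹ * cs.simple i' := by
      have hs : (cs.simple i')⁻¹ * (cs.simple i * (cs.simple i')⁻¹) * q ^ n =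
          (q ^ (n + 1))⁻¹ * cs.simple i' := by
        rw [← simple_mul_rotation_pow cs i i' (n + 1), pow_succ', ← hq_def]
        simp [hq_def, mul_assoc]
      rw [← eq_mul_inv_iff_mul_eq, ← eq_inv_mul_iff_mul_eq, mul_inv_eq_iff_eq_mul, hs,
        ← eq_inv_mul_iff_mul_eq, show 2 * n + 1 = (n + 1) + n by ring, pow_add q (n + 1) n, mul_inv_rev,
        mul_assoc]
    simp only [reflectionStep, h1, h2]
    rw [show 2 * (n + 1) = 2 * n + 1 + 1 by ring, Finset.sum_range_succ, Finset.sum_range_succ]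
    refine Prod.ext ?_ (by simp only [add_assoc])
    simp [pow_succ', hq_def, mul_assoc]

theorem isLiftable_reflectionStep : M.IsLiftable (reflectionStep cs) := by
  classical
  intro i i'
  funext p
  rw [reflectionStep_mul_pow, two_mul, Finset.sum_range_add]
  have hq := cs.simple_mul_simple_pow i i'
  simp only [pow_add, hq, one_mul, inv_one, mul_one, CharTwo.add_self_eq_zero, add_zero]
  rfl

open Classical in
theorem lift_reflectionStep_wordProd (ω : List B) (p : W × ZMod 2) :
    cs.lift ⟨_, isLiftable_reflectionStep cs⟩ (cs.wordProd ω) p =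
      (cs.wordProd ω * p.1 * (cs.wordProd ω)⁻¹, p.2 + (cs.rightInvSeq ω).count p.1) := by
  induction ω with
  | nil => simp; rfl
  | cons i ω ih =>
    rw [cs.wordProd_cons, map_mul, cs.lift_apply_simple]
    change reflectionStep cs i (_) = _
    rw [ih]
    have h : cs.wordProd ω * p.1 * (cs.wordProd ω)⁻¹ = cs.simple i ↔
        (cs.wordProd ω)⁻¹ * cs.simple i * cs.wordProd ω = p.1 := by
      rw [mul_inv_eq_iff_eq_mul, ← eq_inv_mul_iff_mul_eq, mul_assoc, eq_comm]
    simp only [reflectionStep, h, rightInvSeq, List.count_cons, beq_iff_eq]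
    refine Prod.ext (by simp [mul_assoc]) ?_
    push_cast
    rw [add_assoc]

/-- The parity of the multiplicity of an element in the right inversion sequence of a word
depends only on the product of the word. -/
theorem count_rightInvSeq_eq_of_wordProd_eq [DecidableEq W] {ω ω' : List B}
    (h : cs.wordProd ω = cs.wordProd ω') (x : W) :
    ((cs.rightInvSeq ω).count x : ZMod 2) = (cs.rightInvSeq ω').count x := by
  have h1 := lift_reflectionStep_wordProd cs ω (x, 0)
  rw [h, lift_reflectionStep_wordProd cs ω' (x, 0)] at h1
  have := congrArg Prod.snd h1
  simp only [zero_add] at this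
  convert this.symm

theorem rightInvSeq_subset_of_isReduced {ω ω' : List B} (hω : cs.IsReduced ω)
    (h : cs.wordProd ω = cs.wordProd ω') : cs.rightInvSeq ω ⊆ cs.rightInvSeq ω' := by
  classical
  intro x hx
  by_contra hx'
  have hc := count_rightInvSeq_eq_of_wordProd_eq cs h x
  rw [List.count_eq_one_of_mem hω.nodup_rightInvSeq hx, List.count_eq_zero_of_not_mem hx'] at hc
  simp at hc

theorem wordProd_mem {H : Subgroup W} {ω : List B} (h : ∀ i ∈ ω, cs.simple i ∈ H) :
    cs.wordProd ω ∈ H :=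
  H.list_prod_mem (by simpa using h)

theorem rightInvSeq_mem {H : Subgroup W} {ω : List B} (h : ∀ i ∈ ω, cs.simple i ∈ H) :
    ∀ x ∈ cs.rightInvSeq ω, x ∈ H := by
  induction ω with
  | nil => simp
  | cons i ω ih =>
    simp only [List.mem_cons, forall_eq_or_imp] at h
    have hp := wordProd_mem cs h.2
    simp only [rightInvSeq, List.mem_cons, forall_eq_or_imp]
    exact ⟨H.mul_mem (H.mul_mem (H.inv_mem hp) h.1) hp, ih h.2⟩

theorem simple_mem_of_rightInvSeq_mem {H : Subgroup W} {ω : List B}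
    (h : ∀ x ∈ cs.rightInvSeq ω, x ∈ H) : ∀ i ∈ ω, cs.simple i ∈ H := by
  induction ω with
  | nil => simp
  | cons i ω ih =>
    simp only [rightInvSeq, List.mem_cons, forall_eq_or_imp] at h
    have hp := wordProd_mem cs (ih h.2)
    simp only [List.mem_cons, forall_eq_or_imp]
    exact ⟨(H.mul_mem_cancel_left (H.inv_mem hp)).1 ((H.mul_mem_cancel_right hp).1 h.1), ih h.2⟩

theorem exists_word_of_mem_closure {I : Set B} {w : W}
    (hw : w ∈ Subgroup.closure (cs.simple '' I)) :
    ∃ ω : List B, (∀ i ∈ ω, i ∈ I) ∧ cs.wordProd ω = w := by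
  induction hw using Subgroup.closure_induction with
  | mem x hx =>
    obtain ⟨i, hi, rfl⟩ := hx
    exact ⟨[i], by simpa using hi, by simp⟩
  | one => exact ⟨[], by simp, by simp⟩
  | mul x y _ _ hx hy =>
    obtain ⟨ω, h1, rfl⟩ := hx
    obtain ⟨ω', h2, rfl⟩ := hy
    exact ⟨ω ++ ω', fun i hi => (List.mem_append.1 hi).elim (h1 i) (h2 i), by
      simp [cs.wordProd_append]⟩
  | inv x _ hx =>
    obtain ⟨ω, h1, rfl⟩ := hx
    exact ⟨ω.reverse, by simpa using h1, by simp⟩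

/-- The letters of a reduced word of an element of a standard parabolic subgroup are simple
reflections of that subgroup. -/
theorem simple_mem_closure_of_isReduced {I : Set B} {ω : List B} (hω : cs.IsReduced ω)
    (hw : cs.wordProd ω ∈ Subgroup.closure (cs.simple '' I)) :
    ∀ i ∈ ω, cs.simple i ∈ Subgroup.closure (cs.simple '' I) := by
  obtain ⟨ω', h1, h2⟩ := exists_word_of_mem_closure cs hw
  have h3 : ∀ i ∈ ω', cs.simple i ∈ Subgroup.closure (cs.simple '' I) := fun i hi =>
    Subgroup.subset_closure ⟨i, h1 i hi, rfl⟩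
  exact simple_mem_of_rightInvSeq_mem cs fun x hx =>
    rightInvSeq_mem cs h3 x (rightInvSeq_subset_of_isReduced cs hω h2.symm hx)

/-- If the letters of `ω` satisfying `P` commute with those not satisfying `P`, the former can be
moved to the front. -/
theorem wordProd_filter_append (P : B → Prop) [DecidablePred P] {ω : List B}
    (h : ∀ i ∈ ω, ∀ j ∈ ω, P i → ¬ P j → Commute (cs.simple i) (cs.simple j)) :
    cs.wordProd (ω.filter P ++ ω.filter (¬ P ·)) = cs.wordProd ω := by
  induction ω with
  | nil => simp
  | cons i ω ih =>
    have ih := ih fun a ha b hb =>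
      h a (List.mem_cons_of_mem _ ha) b (List.mem_cons_of_mem _ hb)
    rw [cs.wordProd_append] at ih
    by_cases hi : P i
    · simp [hi, cs.wordProd_cons, ← ih, cs.wordProd_append]
    · have hc : Commute (cs.simple i) (cs.wordProd (ω.filter P)) := by
        refine Commute.list_prod_right _ _ fun x hx => ?_
        obtain ⟨a, ha, rfl⟩ := List.mem_map.1 hx
        simp only [List.mem_filter, decide_eq_true_eq] at ha
        exact (h a (List.mem_cons_of_mem _ ha.1) i List.mem_cons_self ha.2 hi).symm
      simp only [hi, List.filter_cons, decide_false, not_false_eq_true, decide_true, if_true,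
        Bool.false_eq_true, if_false, cs.wordProd_cons, cs.wordProd_append, ← ih]
      rw [← mul_assoc, ← hc.eq, mul_assoc]

end ReflectionCocycle

section TypeC

variable {g : ℕ}

/-- The permutation of the coordinates underlying a simple reflection of type `C_g`. -/
def coordPerm (g : ℕ) (i : Fin g) : Equiv.Perm ℕ :=
  if (i : ℕ) < g - 1 then Equiv.swap i (i + 1) else 1

theorem coordPerm_sq (i : Fin g) : coordPerm g i ^ 2 = 1 := by
  unfold coordPerm
  split_ifs <;> simp [pow_two]

theorem commute_coordPerm {i j : Fin g} (h : (i : ℕ) + 1 < j) :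
    Commute (coordPerm g i) (coordPerm g j) := by
  unfold coordPerm
  split_ifs
  · refine (Equiv.Perm.disjoint_iff_eq_or_eq.2 fun x => ?_).commute
    by_cases hx : x = i ∨ x = i + 1
    · exact Or.inr (Equiv.swap_apply_of_ne_of_ne (by omega) (by omega))
    · exact Or.inl (Equiv.swap_apply_of_ne_of_ne (by omega) (by omega))
  all_goals simp

theorem swap_mul_swap_pow_three {α : Type*} [DecidableEq α] {a b c : α} (hab : a ≠ b)
    (hac : a ≠ c) (hbc : b ≠ c) : (Equiv.swap a b * Equiv.swap b c) ^ 3 = 1 := by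
  have h1 := Equiv.swap_mul_swap_mul_swap hbc.symm hac.symm
  have h2 := Equiv.swap_mul_swap_mul_swap hab hac
  rw [Equiv.swap_comm c b, Equiv.swap_comm b a] at h1
  calc (Equiv.swap a b * Equiv.swap b c) ^ 3
      = (Equiv.swap a b * Equiv.swap b c * Equiv.swap a b) *
          (Equiv.swap b c * Equiv.swap a b * Equiv.swap b c) := by
        simp only [pow_succ, pow_zero, one_mul, mul_assoc]
    _ = 1 := by rw [h1, h2, Equiv.swap_comm c a, Equiv.swap_mul_self]

theorem coordPerm_mul_pow_three {i j : Fin g} (h : (i : ℕ) + 1 = j) (hj : (j : ℕ) < g - 1) :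
    (coordPerm g i * coordPerm g j) ^ 3 = 1 := by
  rw [coordPerm, coordPerm, if_pos hj, if_pos (by omega), ← h]
  exact swap_mul_swap_pow_three (by omega) (by omega) (by omega)

theorem isLiftable_coordPerm (g : ℕ) : (CFinMatrix g).IsLiftable (coordPerm g) := by
  intro i j
  change (coordPerm g i * coordPerm g j) ^ cFinEntry g i j = 1
  have hi := i.isLt
  have hj := j.isLt
  have hi2 := coordPerm_sq i
  have hj2 := coordPerm_sq j
  unfold cFinEntry
  split_ifs with h1 h2 h3
  · obtain rfl := Fin.ext h1
    rw [pow_one, ← pow_two, hi2]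
  · have hc : Commute (coordPerm g i) (coordPerm g j) :=
      h2.elim commute_coordPerm fun h => (commute_coordPerm h).symm
    rw [hc.mul_pow, hi2, hj2, one_mul]
  · rcases h3 with h3 | h3
    · have : coordPerm g j = 1 := if_neg (by omega)
      rw [this, mul_one, show 4 = 2 * 2 from rfl, pow_mul, hi2, one_pow]
    · have : coordPerm g i = 1 := if_neg (by omega)
      rw [this, one_mul, show 4 = 2 * 2 from rfl, pow_mul, hj2, one_pow]
  · rcases lt_or_gt_of_ne h1 with h | h
    · exact coordPerm_mul_pow_three (by omega) (by omega)
    · have h' := congrArg (·⁻¹) (coordPerm_mul_pow_three (i := j) (j := i) (by omega) (by omega))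
      rw [pow_two] at hi2 hj2
      simpa only [← inv_pow, mul_inv_rev, inv_eq_of_mul_eq_one_left hi2,
        inv_eq_of_mul_eq_one_left hj2, inv_one] using h'

theorem simple_mem_Wc_iff {W : Type*} [Group W] (cs : CoxeterSystem (CFinMatrix g) W) {c : ℕ}
    (hc : 1 ≤ c) (i : Fin g) : cs.simple i ∈ Wc g cs c ↔ g - c ≤ (i : ℕ) := by
  refine ⟨fun h => ?_, fun h => Subgroup.subset_closure ⟨i, h, rfl⟩⟩
  by_contra! hi
  let φ : W →* Equiv.Perm ℕ := cs.lift ⟨_, isLiftable_coordPerm g⟩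
  have hφ (j : Fin g) : φ (cs.simple j) = coordPerm g j := cs.lift_apply_simple _ j
  have hle : Wc g cs c ≤ (MulAction.stabilizer (Equiv.Perm ℕ) (i : ℕ)).comap φ := by
    refine (Subgroup.closure_le _).2 ?_
    rintro _ ⟨j, hj, rfl⟩
    have hj : g - c ≤ (j : ℕ) := hj
    simp only [SetLike.mem_coe, Subgroup.mem_comap, MulAction.mem_stabilizer_iff, hφ,
      Equiv.Perm.smul_def, coordPerm]
    split_ifs
    · exact Equiv.swap_apply_of_ne_of_ne (by omega) (by omega)
    · rfl
  have h := hle h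
  simp only [Subgroup.mem_comap, MulAction.mem_stabilizer_iff, hφ, Equiv.Perm.smul_def,
    coordPerm, show (i : ℕ) < g - 1 by omega, if_true, Equiv.swap_apply_left] at h
  omega

theorem commute_simple_of_add_one_lt {W : Type*} [Group W]
    (cs : CoxeterSystem (CFinMatrix g) W) {i j : Fin g} (h : (i : ℕ) + 1 < j) :
    Commute (cs.simple i) (cs.simple j) := by
  have h2 := cs.simple_mul_simple_pow i j
  have hM : CFinMatrix g i j = 2 := by
    change cFinEntry g i j = 2
    simp only [cFinEntry]
    split_ifs <;> omega
  rw [hM, pow_two, mul_eq_one_iff_eq_inv, mul_inv_rev, cs.inv_simple, cs.inv_simple] at h2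
  exact h2

end TypeC

/-- Lemma 5.5: let `1 ≤ c ≤ g`. If `w ∈ ᶜW` and `w ∉ ᶜ⁻¹W`, then
`supp(w) = {t_{g−c+1}, t_{g−c+2}, …, t_g}` (in the 0-based indexing of `Fin g`, the set of
indices `≥ g − c`). -/
theorem supp_eq_of_mem_cW_not_mem_pred (g : ℕ) (hg : 2 ≤ g) {W : Type*} [Group W]
    (cs : CoxeterSystem (CFinMatrix g) W) (c : ℕ) (hc1 : 1 ≤ c) (hc2 : c ≤ g)
    (w : W) (hw : w ∈ cW g cs c) (hw' : w ∉ cW g cs (c - 1)) :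
    supp cs w = {j : Fin g | g - c ≤ (j : ℕ)} := by
  have hI {ω : List (Fin g)} (hω : cs.IsReduced ω) (h : cs.wordProd ω = w) :
      ∀ i ∈ ω, g - c ≤ (i : ℕ) := fun i hi =>
    (simple_mem_Wc_iff cs hc1 i).1
      (simple_mem_closure_of_isReduced cs hω (h ▸ hw.1) i hi)
  refine Set.Subset.antisymm (fun i ⟨ω, hω, h, hi⟩ => hI hω h i hi) fun j hj => ?_
  have hj : g - c ≤ (j : ℕ) := hj
  obtain ⟨ω, hω, hωw⟩ := cs.exists_isReduced w
  have hmem := hI hω hωw.symm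
  by_contra hjs
  have hjω : j ∉ ω := fun h => hjs ⟨ω, hω, hωw.symm, h⟩
  obtain ⟨a, haω, ha⟩ : ∃ a ∈ ω, (a : ℕ) = g - c := by
    by_contra! hne
    refine hw' ⟨?_, fun k hk hk' => hw.2 k (by omega) hk'⟩
    rw [hωw]
    refine wordProd_mem cs fun i hi => Subgroup.subset_closure ⟨i, ?_, rfl⟩
    have h1 := hmem i hi
    have h2 := hne i hi
    change g - (c - 1) ≤ (i : ℕ)
    omega
  have hjne (i : Fin g) (hi : i ∈ ω) : (i : ℕ) ≠ j := fun h => hjω (Fin.ext h ▸ hi)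
  have haj := hjne a haω
  let P : Fin g → Prop := fun i => (i : ℕ) < j
  have hprod : cs.wordProd (ω.filter P ++ ω.filter (¬ P ·)) = cs.wordProd ω :=
    wordProd_filter_append cs P fun i hi k hk hPi hPk => by
      have h1 := hjne k hk
      simp only [P] at hPi hPk
      exact commute_simple_of_add_one_lt cs (by omega)
  have hlen : (ω.filter P ++ ω.filter (¬ P ·)).length = ω.length := by
    rw [List.length_append, List.length_eq_length_filter_add (l := ω) (P ·)]
    simp only [decide_not]
  have haP : a ∈ ω.filter P := by
    simp only [List.mem_filter, haω, true_and, decide_eq_true_eq, P]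
    omega
  obtain ⟨b, τ, hbτ⟩ := List.exists_cons_of_ne_nil (List.ne_nil_of_mem haP)
  have hb : b ∈ ω.filter P := hbτ ▸ List.mem_cons_self
  simp only [List.mem_filter, decide_eq_true_eq, P] at hb
  have hdesc := hw.2 b (hmem b hb.1) (by have := j.isLt; omega)
  rw [hbτ, List.cons_append] at hprod hlen
  rw [hωw, ← hprod, cs.wordProd_cons, cs.simple_mul_simple_cancel_left, ← cs.wordProd_cons, hprod,
    hω.eq, ← hlen, List.length_cons] at hdesc
  have := cs.length_wordProd_le (τ ++ ω.filter (¬ P ·))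
  omega
end

section
/- (Criterion for basic Ekedahl–Oort strata.) Identify the finite Weyl group W_g of type C_g with the standard parabolic subgroup of the type-C̃_g Coxeter system generated by {u_1, …, u_g}, via t_i ↦ u_i. Then for every w ∈ ᵍW, the standard parabolic subgroup W_{supp(w) ∪ ι(supp(w))} of the affine Coxeter group is finite if and only if w ∈ ᶜW for some integer c with 0 ≤ c ≤ g/2. -/
/-- The entries of the Coxeter matrix of type `C̃_g` (indices `0, 1, …, g`):
`m(u_i, u_j) = 2` if `|i−j| ≥ 2`, `m(u_0,u_1) = m(u_{g−1},u_g) = 4`, and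
`m(u_i,u_{i+1}) = 3` for `1 ≤ i ≤ g−2`. -/
def cAffEntry (g a b : ℕ) : ℕ :=
  if a = b then 1
  else if a + 1 < b ∨ b + 1 < a then 2
  else if (a = 0 ∧ b = 1) ∨ (b = 0 ∧ a = 1) ∨ (a = g - 1 ∧ b = g) ∨ (b = g - 1 ∧ a = g) then 4
  else 3

/-- The Coxeter matrix of type `C̃_g`, on the index set `{u_0, u_1, …, u_g} = Fin (g+1)`. -/
def CAffMatrix (g : ℕ) : CoxeterMatrix (Fin (g + 1)) where
  M := Matrix.of fun a b => cAffEntry g (a : ℕ) (b : ℕ)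
  isSymm := by
    ext a b
    simp only [Matrix.transpose_apply, Matrix.of_apply, cAffEntry]
    split_ifs <;> omega
  diagonal := by
    intro a
    simp [cAffEntry]
  off_diagonal := by
    intro a b hab
    have h : (a : ℕ) ≠ (b : ℕ) := fun h => hab (Fin.ext h)
    simp only [Matrix.of_apply, cAffEntry]
    split_ifs <;> omega

/-- The standard parabolic subgroup `W_c = ⟨t_{g−c+1}, …, t_g⟩` of the affine Coxeter group
of type `C̃_g`, where `t_i = u_i` (for `0 ≤ c ≤ g`); it is generated by the simple
reflections `u_j` with `g − c + 1 ≤ j ≤ g`.  In particular `W_0` is trivial and `W_g` is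
the finite Weyl group of type `C_g`. -/
def WcAff (g : ℕ) {W : Type*} [Group W] (cs : CoxeterSystem (CAffMatrix g) W) (c : ℕ) :
    Subgroup W :=
  Subgroup.closure (cs.simple '' {j : Fin (g + 1) | g - c < (j : ℕ)})

/-- The set `ᶜW = {w ∈ W_c : ℓ(t_j w) > ℓ(w) for all g−c+1 ≤ j ≤ g−1}` of minimal-length
representatives of the cosets `⟨t_{g−c+1},…,t_{g−1}⟩\W_c`, where `t_i = u_i`. -/
def cWAff (g : ℕ) {W : Type*} [Group W] (cs : CoxeterSystem (CAffMatrix g) W) (c : ℕ) :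
    Set W :=
  {w | w ∈ WcAff g cs c ∧
    ∀ j : Fin (g + 1), g - c < (j : ℕ) → (j : ℕ) < g →
      cs.length w < cs.length (cs.simple j * w)}

namespace CoxeterSystem

variable {B W : Type*} [Group W] {M : CoxeterMatrix B} (cs : CoxeterSystem M W)

open scoped Classical in
/-- The map `(t, ε) ↦ (s t s⁻¹, ε + [t = s])` attached to the simple reflection `s`; it counts
inversions modulo two. -/
noncomputable def inversionStep (i : B) : Function.End (W × ZMod 2) :=
  fun p => (cs.simple i * p.1 * cs.simple i, p.2 + if p.1 = cs.simple i then 1 else 0)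

theorem simple_mul_pow_conj (a b : B) (k : ℕ) :
    cs.simple b * (cs.simple a * cs.simple b) ^ k =
      ((cs.simple a * cs.simple b) ^ k)⁻¹ * cs.simple b := by
  induction k with
  | zero => simp
  | succ k ih =>
    rw [pow_succ, ← mul_assoc, ih, mul_assoc, ← pow_succ, pow_succ', mul_inv_rev]
    simp [mul_assoc]

open scoped Classical in
theorem inversionStep_mul_pow_apply (a b : B) (k : ℕ) (p : W × ZMod 2) :
    ((cs.inversionStep a * cs.inversionStep b) ^ k) p =
      ((cs.simple a * cs.simple b) ^ k * p.1 * ((cs.simple a * cs.simple b) ^ k)⁻¹,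
        p.2 + ∑ j ∈ Finset.range (2 * k),
          if p.1 = cs.simple b * (cs.simple a * cs.simple b) ^ j then 1 else 0) := by
  induction k with
  | zero => simp; rfl
  | succ k ih =>
    have h : ((cs.inversionStep a * cs.inversionStep b) ^ (k + 1)) p =
        cs.inversionStep a (cs.inversionStep b
          (((cs.inversionStep a * cs.inversionStep b) ^ k) p)) := by
      rw [pow_succ']; rfl
    rw [h, ih]
    set σ := cs.simple a * cs.simple b with hσ
    have h₁ : (σ ^ k * p.1 * (σ ^ k)⁻¹ = cs.simple b) ↔ p.1 = cs.simple b * σ ^ (2 * k) := by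
      rw [two_mul, pow_add, ← mul_assoc, hσ, simple_mul_pow_conj, ← hσ, mul_inv_eq_iff_eq_mul,
        mul_assoc, eq_inv_mul_iff_mul_eq]
    have h₂ : (cs.simple b * (σ ^ k * p.1 * (σ ^ k)⁻¹) * cs.simple b = cs.simple a) ↔
        p.1 = cs.simple b * σ ^ (2 * k + 1) := by
      have e : cs.simple b * σ ^ (2 * k + 1) =
          (σ ^ k)⁻¹ * (cs.simple b * cs.simple a * cs.simple b) * σ ^ k := by
        rw [show 2 * k + 1 = k + (1 + k) by ring, pow_add, ← mul_assoc, hσ,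
          simple_mul_pow_conj, ← hσ, pow_add, pow_one, hσ]
        simp only [mul_assoc]
      rw [e]
      constructor
      · intro h
        rw [← h]
        simp [mul_assoc]
      · intro h
        rw [h]
        simp [mul_assoc]
    simp only [inversionStep, h₁, h₂]
    refine Prod.ext ?_ ?_
    · simp [pow_succ', mul_assoc, hσ]
    · rw [show 2 * (k + 1) = 2 * k + 1 + 1 by ring, Finset.sum_range_succ, Finset.sum_range_succ]
      simp only [add_assoc]

theorem isLiftable_inversionStep : M.IsLiftable cs.inversionStep := by
  classical
  intro a b
  funext p
  rw [inversionStep_mul_pow_apply, cs.simple_mul_simple_pow, two_mul, Finset.sum_range_add]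
  simp only [pow_add, cs.simple_mul_simple_pow, one_mul, mul_one, inv_one, CharTwo.add_self_eq_zero,
    add_zero]
  rfl

/-- The action of `W` on `W × ℤ/2` which counts inversions modulo two. -/
noncomputable def inversionHom : W →* Function.End (W × ZMod 2) :=
  cs.lift ⟨cs.inversionStep, cs.isLiftable_inversionStep⟩

theorem inversionHom_simple (i : B) : cs.inversionHom (cs.simple i) = cs.inversionStep i :=
  cs.lift_apply_simple _ i

open scoped Classical in
theorem inversionHom_wordProd (ω : List B) (p : W × ZMod 2) :
    cs.inversionHom (cs.wordProd ω) p =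
      (cs.wordProd ω * p.1 * (cs.wordProd ω)⁻¹, p.2 + (cs.rightInvSeq ω).count p.1) := by
  induction ω with
  | nil => simp; rfl
  | cons i ω ih =>
    have h : cs.inversionHom (cs.wordProd (i :: ω)) p =
        cs.inversionStep i (cs.inversionHom (cs.wordProd ω) p) := by
      rw [wordProd_cons, map_mul, inversionHom_simple]; rfl
    have e : (cs.wordProd ω * p.1 * (cs.wordProd ω)⁻¹ = cs.simple i) ↔
        ((cs.wordProd ω)⁻¹ * cs.simple i * cs.wordProd ω = p.1) := by
      constructor
      · intro h
        rw [← h]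
        group
      · intro h
        rw [← h]
        group
    rw [h, ih]
    simp only [inversionStep, e, rightInvSeq, List.count_cons, wordProd_cons, mul_inv_rev,
      inv_simple, beq_iff_eq]
    refine Prod.ext ?_ ?_
    · simp [mul_assoc]
    · push_cast
      simp [add_assoc]

/-- An element of a subgroup generated by simple reflections flips only the signs of elements of
that subgroup. -/
theorem inversionHom_apply_of_notMem {K : Set B} {w : W}
    (hw : w ∈ Subgroup.closure (cs.simple '' K)) (p : W × ZMod 2)
    (hp : p.1 ∉ Subgroup.closure (cs.simple '' K)) :
    (cs.inversionHom w p).2 = p.2 ∧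
      (cs.inversionHom w p).1 ∉ Subgroup.closure (cs.simple '' K) := by
  have step : ∀ i ∈ K, ∀ q : W × ZMod 2, q.1 ∉ Subgroup.closure (cs.simple '' K) →
      (cs.inversionStep i q).2 = q.2 ∧
        (cs.inversionStep i q).1 ∉ Subgroup.closure (cs.simple '' K) := by
    intro i hi q hq
    have hs : cs.simple i ∈ Subgroup.closure (cs.simple '' K) :=
      Subgroup.subset_closure ⟨i, hi, rfl⟩
    have hne : q.1 ≠ cs.simple i := fun h => hq (h ▸ hs)
    refine ⟨by simp [inversionStep, hne], ?_⟩
    simpa [inversionStep, Subgroup.mul_mem_cancel_right _ hs,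
      Subgroup.mul_mem_cancel_left _ hs] using hq
  induction hw using Subgroup.closure_induction_left with
  | one => rw [map_one]; exact ⟨rfl, hp⟩
  | mul_left x hx y hy ih =>
    obtain ⟨i, hi, rfl⟩ := hx
    rw [map_mul, inversionHom_simple]
    have := step i hi _ ih.2
    exact ⟨this.1.trans ih.1, this.2⟩
  | inv_mul_cancel x hx y hy ih =>
    obtain ⟨i, hi, rfl⟩ := hx
    rw [inv_simple, map_mul, inversionHom_simple]
    have := step i hi _ ih.2
    exact ⟨this.1.trans ih.1, this.2⟩

theorem simple_mem_of_forall_rightInvSeq_mem (P : Subgroup W) (ω : List B)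
    (h : ∀ t ∈ cs.rightInvSeq ω, t ∈ P) : cs.wordProd ω ∈ P ∧ ∀ i ∈ ω, cs.simple i ∈ P := by
  induction ω with
  | nil => simp
  | cons i ω ih =>
    simp only [rightInvSeq, List.mem_cons, forall_eq_or_imp] at h
    obtain ⟨h₁, h₂⟩ := ih h.2
    have hi : cs.simple i ∈ P := by
      simpa [Subgroup.mul_mem_cancel_right _ h₁,
        Subgroup.mul_mem_cancel_left _ (P.inv_mem h₁)] using h.1
    refine ⟨by rw [wordProd_cons]; exact P.mul_mem hi h₁, ?_⟩
    simpa using ⟨hi, h₂⟩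

/-- The letters of a reduced word of an element of a standard parabolic subgroup belong to that
subgroup. -/
theorem IsReduced.simple_mem_of_wordProd_mem {K : Set B} {ω : List B} (hω : cs.IsReduced ω)
    (h : cs.wordProd ω ∈ Subgroup.closure (cs.simple '' K)) {i : B} (hi : i ∈ ω) :
    cs.simple i ∈ Subgroup.closure (cs.simple '' K) := by
  classical
  refine (cs.simple_mem_of_forall_rightInvSeq_mem _ ω fun t ht => ?_).2 i hi
  by_contra hn
  have h₁ := (cs.inversionHom_apply_of_notMem h (t, 0) hn).1
  rw [inversionHom_wordProd] at h₁
  simp [List.count_eq_one_of_mem hω.nodup_rightInvSeq ht] at h₁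

theorem commute_simple {a b : B} (h : M a b = 2) :
    cs.simple a * cs.simple b = cs.simple b * cs.simple a := by
  simpa [braidWord, h, alternatingWord, wordProd, M.symmetric b a] using cs.wordProd_braidWord_eq a b

theorem braid_three {a b : B} (h : M a b = 3) :
    cs.simple a * cs.simple b * cs.simple a = cs.simple b * cs.simple a * cs.simple b := by
  simpa [braidWord, h, alternatingWord, wordProd, M.symmetric b a, mul_assoc] using
    (cs.wordProd_braidWord_eq a b).symm

theorem braid_four {a b : B} (h : M a b = 4) :
    cs.simple a * cs.simple b * cs.simple a * cs.simple b =
      cs.simple b * cs.simple a * cs.simple b * cs.simple a := by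
  simpa [braidWord, h, alternatingWord, wordProd, M.symmetric b a, mul_assoc] using
    cs.wordProd_braidWord_eq a b

end CoxeterSystem

section Chain

variable {G : Type*} [Group G]

/-- The relations of type `C_m` for `t 0, …, t (m - 1)`, where `t 0` is the end with label `4`. -/
structure IsTypeCChain (t : ℕ → G) (m : ℕ) : Prop where
  mul_self : ∀ i < m, t i * t i = 1
  comm : ∀ i j, i + 1 < j → j < m → t i * t j = t j * t i
  braid : ∀ i, 1 ≤ i → i + 1 < m → t i * t (i + 1) * t i = t (i + 1) * t i * t (i + 1)
  braid_four : 1 < m → t 0 * t 1 * t 0 * t 1 = t 1 * t 0 * t 1 * t 0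

/-- The products of the initial segments of `t m, t (m - 1), …, t 0, t 1, …, t m`. -/
def zigzagProd (t : ℕ → G) (m : ℕ) : ℕ → G
  | 0 => 1
  | n + 1 => zigzagProd t m n * t ((n - m) + (m - n))

theorem IsTypeCChain.zigzagProd_mul {t : ℕ → G} {m : ℕ} (h : IsTypeCChain t (m + 1)) (n : ℕ) :
    ∀ s, n ≤ 2 * m + 1 → s ≤ m → s ≠ (n - m) + (m - n) →
      (∀ n', n = n' + 1 → s ≠ (n' - m) + (m - n')) →
      ∃ s' < m, zigzagProd t m n * t s = t s' * zigzagProd t m n := by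
  induction n using Nat.strong_induction_on with
  | _ n ih =>
    intro s hn hs h₁ h₂
    obtain _ | n := n
    · exact ⟨s, by omega, by simp [zigzagProd]⟩
    have hsa := h₂ n rfl
    set a := (n - m) + (m - n) with ha
    have ham : a ≤ m := by omega
    by_cases far : s + 1 < a ∨ a + 1 < s
    · obtain ⟨s', hs', e⟩ := ih n (by omega) s (by omega) hs hsa (by intros; omega)
      refine ⟨s', hs', ?_⟩
      have hc : t a * t s = t s * t a := by
        rcases far with far | far
        · exact (h.comm s a far (by omega)).symm
        · exact h.comm a s far (by omega)
      rw [zigzagProd, ← ha, mul_assoc, hc, ← mul_assoc, e, mul_assoc]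
    obtain _ | n := n
    · omega
    have hsn : s = (n - m) + (m - n) := by omega
    by_cases hs0 : s = 0
    · obtain _ | n := n
      · omega
      have ha1 : a = 1 := by omega
      have hb1 : (n - m) + (m - n) = 1 := by omega
      obtain ⟨s', hs', e⟩ := ih n (by omega) 0 (by omega) (by omega) (by omega)
        (by intros; omega)
      refine ⟨s', hs', ?_⟩
      have hf := h.braid_four (by omega)
      rw [zigzagProd, zigzagProd, zigzagProd, ← ha, ← hsn, hb1, ha1, hs0]
      calc zigzagProd t m n * t 1 * t 0 * t 1 * t 0
          = zigzagProd t m n * (t 1 * t 0 * t 1 * t 0) := by simp only [mul_assoc]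
        _ = (zigzagProd t m n * t 0) * t 1 * t 0 * t 1 := by rw [← hf]; simp only [mul_assoc]
        _ = _ := by rw [e]; simp only [mul_assoc]
    · obtain ⟨s', hs', e⟩ := ih n (by omega) a (by omega) (by omega) (by omega)
        (by intros; omega)
      refine ⟨s', hs', ?_⟩
      have hb : t s * t a * t s = t a * t s * t a := by
        rcases (by omega : a = s + 1 ∨ s = a + 1) with h' | h'
        · rw [h']; exact h.braid s (by omega) (by omega)
        · rw [h']; exact (h.braid a (by omega) (by omega)).symm
      rw [zigzagProd, zigzagProd, ← ha, ← hsn]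
      calc zigzagProd t m n * t s * t a * t s
          = zigzagProd t m n * (t s * t a * t s) := by simp only [mul_assoc]
        _ = (zigzagProd t m n * t a) * t s * t a := by rw [hb]; simp only [mul_assoc]
        _ = _ := by rw [e]; simp only [mul_assoc]

/-- A group generated by elements satisfying the relations of type `C_m` is finite. -/
theorem IsTypeCChain.finite_closure {t : ℕ → G} {m : ℕ} (h : IsTypeCChain t m) :
    (Subgroup.closure (t '' {i | i < m}) : Set G).Finite := by
  induction m with
  | zero => simp
  | succ m ih =>
    have hfin := ih ⟨fun i hi => h.mul_self i (by omega), fun i j hi hj => h.comm i j hi (by omega),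
      fun i hi hj => h.braid i hi (by omega), fun hm => h.braid_four (by omega)⟩
    set H := Subgroup.closure (t '' {i | i < m}) with hH
    refine (hfin.image2 (fun a b => a * b)
      ((Set.finite_Iic (2 * m + 1)).image (zigzagProd t m))).subset ?_
    have key : ∀ x ∈ Set.image2 (fun a b => a * b) (H : Set G)
        (zigzagProd t m '' Set.Iic (2 * m + 1)), ∀ s < m + 1,
        x * t s ∈ Set.image2 (fun a b => a * b) (H : Set G)
          (zigzagProd t m '' Set.Iic (2 * m + 1)) := by
      rintro _ ⟨a, ha, _, ⟨n, hn, rfl⟩, rfl⟩ s hs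
      simp only [Set.mem_Iic] at hn
      by_cases h₁ : s = (n - m) + (m - n)
      · refine ⟨a, ha, _, ⟨n + 1, by simp only [Set.mem_Iic]; omega, rfl⟩, ?_⟩
        simp only [zigzagProd]
        rw [← h₁, mul_assoc]
      by_cases h₂ : ∃ n', n = n' + 1 ∧ s = (n' - m) + (m - n')
      · obtain ⟨n', rfl, hs'⟩ := h₂
        refine ⟨a, ha, _, ⟨n', by simp only [Set.mem_Iic]; omega, rfl⟩, ?_⟩
        simp only [zigzagProd]
        rw [← hs', mul_assoc, mul_assoc, h.mul_self s hs, mul_one]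
      · push Not at h₂
        obtain ⟨s', hs', e⟩ := h.zigzagProd_mul n s hn (by omega) h₁ h₂
        refine ⟨a * t s', H.mul_mem ha (Subgroup.subset_closure ⟨s', hs', rfl⟩), _,
          ⟨n, hn, rfl⟩, ?_⟩
        simp only
        rw [mul_assoc, ← e, mul_assoc]
    intro x hx
    induction (show x ∈ Subgroup.closure (t '' {i | i < m + 1}) from hx)
      using Subgroup.closure_induction_right with
    | one => exact ⟨1, H.one_mem, 1, ⟨0, by simp, rfl⟩, by simp⟩
    | mul_right x hx' y hy ihx =>
      obtain ⟨s, hs, rfl⟩ := hy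
      exact key x (ihx hx') s hs
    | mul_inv_cancel x hx' y hy ihx =>
      obtain ⟨s, hs, rfl⟩ := hy
      rw [inv_eq_of_mul_eq_one_right (h.mul_self s hs)]
      exact key x (ihx hx') s hs

end Chain

section Walk

/-- The walk on `0, …, g` which bounces at both ends, as a function of time. -/
def bounce (g : ℕ) (p : ℤ) : ℤ :=
  if p % (2 * g) ≤ g then p % (2 * g) else 2 * g - p % (2 * g)

theorem bounce_of_mem (g : ℕ) {p : ℤ} (h₀ : 0 ≤ p) (h₁ : p ≤ g) : bounce g p = p := by
  obtain h | h := h₀.eq_or_lt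
  · simp [bounce, ← h]
  · rw [bounce, Int.emod_eq_of_lt h₀ (by omega), if_pos h₁]

theorem bounce_nonneg_le (g : ℕ) (hg : 0 < g) (p : ℤ) : 0 ≤ bounce g p ∧ bounce g p ≤ g := by
  have h₁ := Int.emod_nonneg p (show (2 * g : ℤ) ≠ 0 by omega)
  have h₂ := Int.emod_lt_of_pos p (show (0 : ℤ) < 2 * g by omega)
  rw [bounce]
  split_ifs <;> omega

theorem emod_add_one (N p : ℤ) (hN : 0 < N) :
    (p + 1) % N = if p % N = N - 1 then 0 else p % N + 1 := by
  have h₁ := Int.emod_nonneg p hN.ne'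
  have h₂ := Int.emod_lt_of_pos p hN
  rw [← Int.emod_add_emod]
  split_ifs with h
  · rw [h]; simp
  · exact Int.emod_eq_of_lt (by omega) (by omega)

theorem bounce_add_two (g : ℕ) (hg : 0 < g) (p : ℤ) :
    bounce g (p + 2) = if bounce g (p + 1) = 0 then 2 - bounce g p
      else if bounce g (p + 1) = g then 2 * g - 2 - bounce g p
      else 2 * bounce g (p + 1) - bounce g p := by
  have h₁ := Int.emod_nonneg p (show (2 * g : ℤ) ≠ 0 by omega)
  have h₂ := Int.emod_lt_of_pos p (show (0 : ℤ) < 2 * g by omega)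
  have e₁ := emod_add_one (2 * g) p (by omega)
  have e₂ := emod_add_one (2 * g) (p + 1) (by omega)
  rw [show p + 1 + 1 = p + 2 by ring] at e₂
  simp only [bounce]
  grind

theorem bounce_add_one (g : ℕ) (hg : 0 < g) (p : ℤ) :
    bounce g (p + 1) = bounce g p + 1 ∨ bounce g (p + 1) = bounce g p - 1 := by
  have h₁ := Int.emod_nonneg p (show (2 * g : ℤ) ≠ 0 by omega)
  have h₂ := Int.emod_lt_of_pos p (show (0 : ℤ) < 2 * g by omega)
  have e₁ := emod_add_one (2 * g) p (by omega)
  simp only [bounce]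
  grind

/-- The map exchanging `p - 1` and `p` for every time `p` at which the bouncing walk is at `i`. -/
def walkStep (g : ℕ) (i : ℤ) : Function.End ℤ :=
  fun p => if bounce g p = i then p - 1 else if bounce g (p + 1) = i then p + 1 else p

theorem walkStep_mul_self (g : ℕ) (hg : 0 < g) (i : ℤ) : walkStep g i * walkStep g i = 1 := by
  funext p
  change walkStep g i (walkStep g i p) = p
  have h₁ := bounce_add_one g hg
  have h₂ := h₁ (p - 1)
  have h₃ := h₁ p
  have h₄ := h₁ (p + 1)
  simp only [walkStep]
  grind

theorem walkStep_comm (g : ℕ) (hg : 0 < g) (i j : ℤ) (hij : i + 1 < j) :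
    walkStep g i * walkStep g j = walkStep g j * walkStep g i := by
  funext p
  change walkStep g i (walkStep g j p) = walkStep g j (walkStep g i p)
  have h₁ := bounce_add_one g hg
  have h₂ := h₁ (p - 1)
  have h₃ := h₁ p
  have h₄ := h₁ (p + 1)
  simp only [walkStep]
  grind

theorem walkStep_of_eq {g : ℕ} {i p : ℤ} (h : bounce g p = i) : walkStep g i p = p - 1 := by
  simp [walkStep, h]

theorem walkStep_of_add_one_eq {g : ℕ} (hg : 0 < g) {i p : ℤ} (h : bounce g (p + 1) = i) :
    walkStep g i p = p + 1 := by
  have := bounce_add_one g hg p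
  rw [walkStep, if_neg (by omega), if_pos h]

theorem walkStep_of_ne {g : ℕ} {i p : ℤ} (h : bounce g p ≠ i) (h' : bounce g (p + 1) ≠ i) :
    walkStep g i p = p := by
  simp [walkStep, h, h']

theorem braid_three_of_block {S T : ℤ → ℤ} {q p : ℤ} (hS₀ : S q = q + 1) (hS₁ : S (q + 1) = q)
    (hS₂ : S (q + 2) = q + 2) (hT₀ : T q = q) (hT₁ : T (q + 1) = q + 2) (hT₂ : T (q + 2) = q + 1)
    (hp : p = q ∨ p = q + 1 ∨ p = q + 2) : S (T (S p)) = T (S (T p)) := by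
  rcases hp with rfl | rfl | rfl <;> simp [*]

theorem braid_four_of_block {S T : ℤ → ℤ} {q p : ℤ} (hS₀ : S q = q + 1) (hS₁ : S (q + 1) = q)
    (hS₂ : S (q + 2) = q + 3) (hS₃ : S (q + 3) = q + 2) (hT₀ : T q = q) (hT₁ : T (q + 1) = q + 2)
    (hT₂ : T (q + 2) = q + 1) (hT₃ : T (q + 3) = q + 3)
    (hp : p = q ∨ p = q + 1 ∨ p = q + 2 ∨ p = q + 3) :
    S (T (S (T p))) = T (S (T (S p))) := by
  rcases hp with rfl | rfl | rfl | rfl <;> simp [*]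

theorem walkStep_add_of_eq {g : ℕ} {i p d : ℤ} (h : bounce g (p + d) = i) :
    walkStep g i (p + d) = p + (d - 1) := by
  rw [walkStep_of_eq h]; ring

theorem walkStep_add_of_add_one_eq {g : ℕ} (hg : 0 < g) {i p d : ℤ}
    (h : bounce g (p + (d + 1)) = i) : walkStep g i (p + d) = p + (d + 1) := by
  rw [walkStep_of_add_one_eq hg (by rwa [add_assoc])]; ring

theorem walkStep_add_of_ne {g : ℕ} {i p d : ℤ} (h : bounce g (p + d) ≠ i)
    (h' : bounce g (p + (d + 1)) ≠ i) : walkStep g i (p + d) = p + d :=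
  walkStep_of_ne h (by rwa [add_assoc])

theorem bounce_add_two_of_interior {g : ℕ} (hg : 0 < g) {p : ℤ} (h₀ : 0 < bounce g (p + 1))
    (h₁ : bounce g (p + 1) < g) : bounce g (p + 2) = 2 * bounce g (p + 1) - bounce g p := by
  rw [bounce_add_two g hg, if_neg h₀.ne', if_neg h₁.ne]

theorem walkStep_braid_three_ascending {g : ℕ} (hg : 0 < g) {i p : ℤ} (hi : 0 < i)
    (hig : i + 1 < g) (q : ℤ) (h₁ : bounce g (q + 1) = i) (h₂ : bounce g (q + 2) = i + 1)
    (hp : p = q ∨ p = q + 1 ∨ p = q + 2) :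
    walkStep g i (walkStep g (i + 1) (walkStep g i p)) =
      walkStep g (i + 1) (walkStep g i (walkStep g (i + 1) p)) := by
  have k₀ := @bounce_add_two_of_interior g hg q (by omega) (by omega)
  have k₁ := @bounce_add_two_of_interior g hg (q + 1)
  simp only [add_assoc, Int.reduceAdd] at k₁
  have h₀ : bounce g q = i - 1 := by omega
  have h₃ : bounce g (q + 3) = i + 2 := by rw [k₁ (by omega) (by omega)]; omega
  clear k₀ k₁
  exact braid_three_of_block (walkStep_of_add_one_eq hg h₁)
    (by simpa using walkStep_add_of_eq h₁)
    (walkStep_add_of_ne (by omega) (by simp only [Int.reduceAdd]; omega))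
    (walkStep_of_ne (by omega) (by omega))
    (walkStep_add_of_add_one_eq hg h₂) (walkStep_add_of_eq h₂) hp

theorem walkStep_braid_three_descending {g : ℕ} (hg : 0 < g) {i p : ℤ} (hi : 0 < i)
    (hig : i + 1 < g) (q : ℤ) (h₁ : bounce g (q + 1) = i + 1) (h₂ : bounce g (q + 2) = i)
    (hp : p = q ∨ p = q + 1 ∨ p = q + 2) :
    walkStep g i (walkStep g (i + 1) (walkStep g i p)) =
      walkStep g (i + 1) (walkStep g i (walkStep g (i + 1) p)) := by
  have k₀ := @bounce_add_two_of_interior g hg q (by omega) (by omega)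
  have k₁ := @bounce_add_two_of_interior g hg (q + 1)
  simp only [add_assoc, Int.reduceAdd] at k₁
  have h₀ : bounce g q = i + 2 := by omega
  have h₃ : bounce g (q + 3) = i - 1 := by rw [k₁ (by omega) (by omega)]; omega
  clear k₀ k₁
  exact (braid_three_of_block (walkStep_of_add_one_eq hg h₁)
    (by simpa using walkStep_add_of_eq h₁)
    (walkStep_add_of_ne (by omega) (by simp only [Int.reduceAdd]; omega))
    (walkStep_of_ne (by omega) (by omega))
    (walkStep_add_of_add_one_eq hg h₂) (walkStep_add_of_eq h₂) hp).symm

theorem walkStep_braid_three (g : ℕ) (hg : 0 < g) (i : ℤ) (hi : 0 < i) (hig : i + 1 < g) :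
    walkStep g i * walkStep g (i + 1) * walkStep g i =
      walkStep g (i + 1) * walkStep g i * walkStep g (i + 1) := by
  funext p
  change walkStep g i (walkStep g (i + 1) (walkStep g i p)) =
    walkStep g (i + 1) (walkStep g i (walkStep g (i + 1) p))
  have e₁ := bounce_add_one g hg p
  have k₁ := @bounce_add_two_of_interior g hg p
  have k₀ := @bounce_add_two_of_interior g hg (p - 1)
  rw [show p - 1 + 1 = p by ring, show p - 1 + 2 = p + 1 by ring] at k₀
  have up := fun q => @walkStep_braid_three_ascending g hg i p hi hig q
  have down := fun q => @walkStep_braid_three_descending g hg i p hi hig q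
  by_cases c₁ : bounce g p = i
  · have k := k₀ (by omega) (by omega)
    rcases e₁ with e₁ | e₁
    · have h : bounce g (p + 1) = i + 1 := by omega
      exact up (p - 1) (by rwa [sub_add_cancel]) (by rwa [show p - 1 + 2 = p + 1 by ring])
        (by simp)
    · have h : bounce g (p - 1) = i + 1 := by omega
      exact down (p - 2) (by rwa [show p - 2 + 1 = p - 1 by ring]) (by rwa [sub_add_cancel])
        (by simp)
  by_cases c₂ : bounce g p = i + 1
  · have k := k₀ (by omega) (by omega)
    rcases e₁ with e₁ | e₁
    · have h : bounce g (p - 1) = i := by omega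
      exact up (p - 2) (by rwa [show p - 2 + 1 = p - 1 by ring]) (by rwa [sub_add_cancel])
        (by simp)
    · have h : bounce g (p + 1) = i := by omega
      exact down (p - 1) (by rwa [sub_add_cancel]) (by rwa [show p - 1 + 2 = p + 1 by ring])
        (by simp)
  by_cases c₃ : bounce g (p + 1) = i
  · have k := k₁ (by omega) (by omega)
    exact up p c₃ (by omega) (by simp)
  by_cases c₄ : bounce g (p + 1) = i + 1
  · have k := k₁ (by omega) (by omega)
    exact down p c₄ (by omega) (by simp)
  rw [walkStep_of_ne c₁ c₃, walkStep_of_ne c₂ c₄, walkStep_of_ne c₁ c₃, walkStep_of_ne c₂ c₄]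

theorem walkStep_braid_four (g : ℕ) (hg : 2 ≤ g) (e n : ℤ)
    (he : e = 0 ∧ n = 1 ∨ e = g ∧ n = g - 1) :
    walkStep g n * walkStep g e * walkStep g n * walkStep g e =
      walkStep g e * walkStep g n * walkStep g e * walkStep g n := by
  have hg' : 0 < g := by omega
  have hn : 0 < n ∧ n < g := by omega
  have hen : (e < n ∧ ∀ p, bounce g p ≠ 2 * e - n) ∨ (n < e ∧ ∀ p, bounce g p ≠ 2 * e - n) := by
    rcases he with he | he
    · exact .inl ⟨by omega, fun p => by have := bounce_nonneg_le g hg' p; omega⟩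
    · exact .inr ⟨by omega, fun p => by have := bounce_nonneg_le g hg' p; omega⟩
  have hne : ∀ p, bounce g p = e → bounce g (p + 1) = n := by
    intro p hp
    have b := bounce_nonneg_le g hg' (p + 1)
    have := bounce_add_one g hg' p
    omega
  have hne' : ∀ p, bounce g (p + 1) = e → bounce g p = n := by
    intro p hp
    have b := bounce_nonneg_le g hg' p
    have := bounce_add_one g hg' p
    omega
  clear hen
  funext p
  change walkStep g n (walkStep g e (walkStep g n (walkStep g e p))) =
    walkStep g e (walkStep g n (walkStep g e (walkStep g n p)))
  have block : ∀ q, bounce g (q + 2) = e → (p = q ∨ p = q + 1 ∨ p = q + 2 ∨ p = q + 3) →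
      walkStep g n (walkStep g e (walkStep g n (walkStep g e p))) =
        walkStep g e (walkStep g n (walkStep g e (walkStep g n p))) := by
    intro q h₂ hp
    have h₁ := hne' (q + 1)
    have h₃ := hne (q + 2)
    have k₀ := @bounce_add_two_of_interior g hg' q
    have k₂ := @bounce_add_two_of_interior g hg' (q + 2)
    simp only [add_assoc, Int.reduceAdd] at h₁ h₃ k₂
    replace h₁ := h₁ h₂
    replace h₃ := h₃ h₂
    replace k₀ := k₀ (by omega) (by omega)
    replace k₂ := k₂ (by omega) (by omega)
    have h₀ : bounce g q ≠ e ∧ bounce g q ≠ n := by omega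
    have h₄ : bounce g (q + 4) ≠ e ∧ bounce g (q + 4) ≠ n := by omega
    exact braid_four_of_block (walkStep_of_add_one_eq hg' h₁)
      (by simpa using walkStep_add_of_eq h₁) (walkStep_add_of_add_one_eq hg' h₃)
      (walkStep_add_of_eq h₃) (walkStep_of_ne h₀.1 (by omega))
      (walkStep_add_of_add_one_eq hg' h₂) (walkStep_add_of_eq h₂)
      (walkStep_add_of_ne (by omega) h₄.1) hp
  have e₁ := bounce_add_one g hg' p
  have k₁ := @bounce_add_two_of_interior g hg' p
  have k₀ := @bounce_add_two_of_interior g hg' (p - 1)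
  rw [show p - 1 + 1 = p by ring, show p - 1 + 2 = p + 1 by ring] at k₀
  by_cases c₁ : bounce g p = e
  · exact block (p - 2) (by rwa [sub_add_cancel]) (by simp)
  by_cases c₂ : bounce g (p + 1) = e
  · exact block (p - 1) (by rwa [show p - 1 + 2 = p + 1 by ring]) (by simp)
  by_cases c₃ : bounce g p = n
  · have k := k₀ (by omega) (by omega)
    have h : bounce g (p - 1) = e := by omega
    exact block (p - 3) (by rwa [show p - 3 + 2 = p - 1 by ring]) (by simp)
  by_cases c₄ : bounce g (p + 1) = n
  · have k := k₁ (by omega) (by omega)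
    exact block p (by omega) (by simp)
  simp only [walkStep_of_ne c₁ c₂, walkStep_of_ne c₃ c₄]

end Walk

section MonoidRelations

variable {N : Type*} [Monoid N] {a b : N}

theorem mul_pow_two_eq_one_of_comm (ha : a * a = 1) (hb : b * b = 1) (h : a * b = b * a) :
    (a * b) ^ 2 = 1 := by
  calc (a * b) ^ 2 = a * (b * a) * b := by simp only [pow_two, mul_assoc]
    _ = a * a * (b * b) := by rw [← h]; simp only [mul_assoc]
    _ = 1 := by rw [ha, hb, one_mul]

theorem mul_pow_three_eq_one_of_braid (ha : a * a = 1) (hb : b * b = 1)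
    (h : a * b * a = b * a * b) : (a * b) ^ 3 = 1 := by
  calc (a * b) ^ 3 = a * b * a * (b * a * b) := by
        simp only [pow_succ, pow_zero, one_mul, mul_assoc]
    _ = b * (a * (b * b) * a) * b := by rw [h]; simp only [mul_assoc]
    _ = 1 := by rw [hb, mul_one, ha, mul_one, hb]

theorem mul_pow_four_eq_one_of_braid (ha : a * a = 1) (hb : b * b = 1)
    (h : a * b * a * b = b * a * b * a) : (a * b) ^ 4 = 1 := by
  calc (a * b) ^ 4 = a * b * a * b * (a * b * a * b) := by
        simp only [pow_succ, pow_zero, one_mul, mul_assoc]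
    _ = b * (a * (b * (a * a) * b) * a) * b := by nth_rewrite 1 [h]; simp only [mul_assoc]
    _ = 1 := by rw [ha, mul_one, hb, mul_one, ha, mul_one, hb]

end MonoidRelations

theorem Subgroup.finite_sup_of_commute {G : Type*} [Group G] {A B : Subgroup G}
    (hA : (A : Set G).Finite) (hB : (B : Set G).Finite) (h : ∀ a ∈ A, ∀ b ∈ B, Commute a b) :
    ((A ⊔ B : Subgroup G) : Set G).Finite := by
  have := hA.to_subtype
  have := hB.to_subtype
  have hr := MonoidHom.noncommCoprod_range A.subtype B.subtype fun a b => h a a.2 b b.2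
  rw [A.range_subtype, B.range_subtype] at hr
  rw [← hr, MonoidHom.coe_range]
  exact Set.finite_range _

theorem Subgroup.commute_of_mem_closure {G : Type*} [Group G] {S T : Set G}
    (h : ∀ a ∈ S, ∀ b ∈ T, Commute a b) {a b : G} (ha : a ∈ Subgroup.closure S)
    (hb : b ∈ Subgroup.closure T) : Commute a b := by
  induction ha using Subgroup.closure_induction with
  | mem a ha =>
    induction hb using Subgroup.closure_induction with
    | mem b hb => exact h a ha b hb
    | one => exact Commute.one_right a
    | mul _ _ _ _ h₁ h₂ => exact h₁.mul_right h₂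
    | inv _ _ h₁ => exact h₁.inv_right
  | one => exact Commute.one_left b
  | mul _ _ _ _ h₁ h₂ => exact h₁.mul_left h₂
  | inv _ _ h₁ => exact h₁.inv_left

section Affine

theorem isLiftable_walkStep {g : ℕ} (hg : 2 ≤ g) :
    (CAffMatrix g).IsLiftable fun i : Fin (g + 1) => walkStep g ((i : ℕ) : ℤ) := by
  intro i j
  have hsq := walkStep_mul_self g (by omega)
  have hi := i.isLt
  have hj := j.isLt
  change (walkStep g (i : ℕ) * walkStep g (j : ℕ)) ^ cAffEntry g i j = 1
  unfold cAffEntry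
  split_ifs with h₁ h₂ h₃
  · rw [h₁, pow_one, hsq]
  · refine mul_pow_two_eq_one_of_comm (hsq _) (hsq _) ?_
    rcases h₂ with h₂ | h₂
    · exact walkStep_comm g (by omega) _ _ (by omega)
    · exact (walkStep_comm g (by omega) _ _ (by omega)).symm
  · refine mul_pow_four_eq_one_of_braid (hsq _) (hsq _) ?_
    by_cases h : (j : ℕ) = 0 ∧ (i : ℕ) = 1 ∨ (j : ℕ) = g ∧ (i : ℕ) = g - 1
    · exact walkStep_braid_four g hg _ _ (by omega)
    · exact (walkStep_braid_four g hg _ _ (by omega)).symm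
  · refine mul_pow_three_eq_one_of_braid (hsq _) (hsq _) ?_
    obtain h | h : (j : ℕ) = i + 1 ∨ (i : ℕ) = j + 1 := by omega
    · rw [h, Nat.cast_succ]
      exact walkStep_braid_three g (by omega) _ (by omega) (by omega)
    · rw [h, Nat.cast_succ]
      exact (walkStep_braid_three g (by omega) _ (by omega) (by omega)).symm

variable {g : ℕ} {W : Type*} [Group W] (cs : CoxeterSystem (CAffMatrix g) W)

/-- The action of the affine Coxeter group of type `C̃_g` on `ℤ` in which the simple reflections
act by `walkStep`. -/
def walkHom (hg : 2 ≤ g) : W →* Function.End ℤ :=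
  cs.lift ⟨_, isLiftable_walkStep hg⟩

theorem walkHom_simple (hg : 2 ≤ g) (i : Fin (g + 1)) :
    walkHom cs hg (cs.simple i) = walkStep g ((i : ℕ) : ℤ) :=
  cs.lift_apply_simple (isLiftable_walkStep hg) i

theorem walkHom_mul_apply (hg : 2 ≤ g) (v w : W) (p : ℤ) :
    walkHom cs hg (v * w) p = walkHom cs hg v (walkHom cs hg w p) := by
  rw [map_mul]; rfl

theorem exists_eq_bounce (hg : 0 < g) (p : ℤ) : ∃ i : Fin (g + 1), bounce g p = ((i : ℕ) : ℤ) := by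
  obtain ⟨h₀, h₁⟩ := bounce_nonneg_le g hg p
  exact ⟨⟨(bounce g p).toNat, by omega⟩, by simp [h₀]⟩

theorem exists_walkHom_zero_eq (hg : 2 ≤ g) (n : ℤ) : ∃ w : W, walkHom cs hg w 0 = n := by
  induction n using Int.induction_on with
  | zero => exact ⟨1, by rw [map_one]; rfl⟩
  | succ n ih =>
    obtain ⟨w, hw⟩ := ih
    obtain ⟨i, hi⟩ := exists_eq_bounce (g := g) (by omega) (n + 1)
    exact ⟨cs.simple i * w, by
      rw [walkHom_mul_apply, hw, walkHom_simple, walkStep_of_add_one_eq (by omega) hi]⟩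
  | pred n ih =>
    obtain ⟨w, hw⟩ := ih
    obtain ⟨i, hi⟩ := exists_eq_bounce (g := g) (by omega) (-n)
    exact ⟨cs.simple i * w, by rw [walkHom_mul_apply, hw, walkHom_simple, walkStep_of_eq hi]⟩

theorem infinite_of_coxeterSystem_CAffMatrix {g : ℕ} (hg : 2 ≤ g) {W : Type*} [Group W]
    (cs : CoxeterSystem (CAffMatrix g) W) : Infinite W :=
  Infinite.of_surjective (fun w : W => walkHom cs hg w 0) (exists_walkHom_zero_eq cs hg)

theorem le_walkHom_iff (hg : 2 ≤ g) {K : Set (Fin (g + 1))} {i : Fin (g + 1)} (hi : i ∉ K) {w : W}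
    (hw : w ∈ Subgroup.closure (cs.simple '' K)) (p : ℤ) :
    ((i : ℕ) : ℤ) ≤ walkHom cs hg w p ↔ ((i : ℕ) : ℤ) ≤ p := by
  induction hw using Subgroup.closure_induction generalizing p with
  | mem x hx =>
    obtain ⟨j, hj, rfl⟩ := hx
    have hij : (i : ℕ) ≠ j := fun h => hi (Fin.ext h ▸ hj)
    have hb := bounce_of_mem g (p := ((i : ℕ) : ℤ)) (by omega) (by omega)
    rw [walkHom_simple, walkStep]
    split_ifs with h₁ h₂
    · have : p ≠ (i : ℕ) := by rintro rfl; omega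
      omega
    · have : p + 1 ≠ (i : ℕ) := by intro h; rw [h] at h₂; omega
      omega
    · rfl
  | one => rw [map_one]; rfl
  | mul x y _ _ hx hy => rw [walkHom_mul_apply, hx, hy]
  | inv x _ hx => rw [← hx, ← walkHom_mul_apply, mul_inv_cancel, map_one]; rfl

theorem mem_of_simple_mem_closure (hg : 2 ≤ g) {K : Set (Fin (g + 1))} {i : Fin (g + 1)}
    (h : cs.simple i ∈ Subgroup.closure (cs.simple '' K)) : i ∈ K := by
  by_contra hi
  have hp := le_walkHom_iff cs hg hi h (i : ℕ)
  rw [walkHom_simple, walkStep_of_eq (bounce_of_mem g (by omega) (by omega))] at hp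
  omega

theorem supp_subset_of_mem_closure (hg : 2 ≤ g) {K : Set (Fin (g + 1))} {w : W}
    (hw : w ∈ Subgroup.closure (cs.simple '' K)) : supp cs w ⊆ K := by
  rintro i ⟨ω, hω, rfl, hi⟩
  exact mem_of_simple_mem_closure cs hg
    (CoxeterSystem.IsReduced.simple_mem_of_wordProd_mem cs hω hw hi)

theorem wordProd_mem_closure {K : Set (Fin (g + 1))} {ω : List (Fin (g + 1))}
    (h : ∀ i ∈ ω, i ∈ K) : cs.wordProd ω ∈ Subgroup.closure (cs.simple '' K) := by
  refine Subgroup.list_prod_mem _ fun x hx => ?_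
  obtain ⟨i, hi, rfl⟩ := List.mem_map.1 hx
  exact Subgroup.subset_closure ⟨i, h i hi, rfl⟩

theorem simple_comm_of_lt {i j : Fin (g + 1)} (h : (i : ℕ) + 1 < j) :
    cs.simple i * cs.simple j = cs.simple j * cs.simple i :=
  cs.commute_simple (show cAffEntry g i j = 2 by unfold cAffEntry; split_ifs <;> omega)

/-- If a word contains the letter `i` but not `i + 1`, then some letter `j ≤ i` can be moved to
the front and cancelled. -/
theorem exists_simple_mul_wordProd_eq {i : Fin (g + 1)} {ω : List (Fin (g + 1))} (hi : i ∈ ω)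
    (h : ∀ j ∈ ω, (j : ℕ) ≠ i + 1) :
    ∃ j ∈ ω, j ≤ i ∧ ∃ ω', ω'.length + 1 = ω.length ∧
      cs.simple j * cs.wordProd ω = cs.wordProd ω' := by
  induction ω with
  | nil => simp at hi
  | cons k τ ih =>
    by_cases hk : k ≤ i
    · exact ⟨k, by simp, hk, τ, by simp, by simp [cs.wordProd_cons]⟩
    · obtain ⟨j, hj, hji, τ', hlen, hτ'⟩ := ih
        ((List.mem_cons.1 hi).resolve_left fun e => hk e.ge) fun j hj => h j (by simp [hj])
      refine ⟨j, by simp [hj], hji, k :: τ', by simp [hlen], ?_⟩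
      have hk' := h k (by simp)
      rw [cs.wordProd_cons, cs.wordProd_cons, ← mul_assoc,
        simple_comm_of_lt cs (by omega), mul_assoc, hτ']

theorem exists_mem_eq_add_one {i : Fin (g + 1)} {ω : List (Fin (g + 1))} (hω : cs.IsReduced ω)
    (hpos : ∀ j ∈ ω, 0 < (j : ℕ))
    (hmin : ∀ j : Fin (g + 1), 0 < (j : ℕ) → (j : ℕ) < g →
      cs.length (cs.wordProd ω) < cs.length (cs.simple j * cs.wordProd ω))
    (hi : i ∈ ω) (hig : (i : ℕ) < g) : ∃ j ∈ ω, (j : ℕ) = i + 1 := by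
  by_contra! h
  obtain ⟨j, hj, hji, ω', hlen, hω'⟩ := exists_simple_mul_wordProd_eq cs hi h
  have hlt := hmin j (hpos j hj) (by omega)
  rw [hω', hω] at hlt
  have := cs.length_wordProd_le ω'
  omega

theorem isTypeCChain_simple {m : ℕ} (hm : m ≤ g) :
    IsTypeCChain (fun i => cs.simple (Fin.ofNat (g + 1) i)) m where
  mul_self i _ := cs.simple_mul_simple_self _
  comm i j hij hj := simple_comm_of_lt cs (by
    rw [Fin.val_ofNat, Fin.val_ofNat, Nat.mod_eq_of_lt, Nat.mod_eq_of_lt] <;> omega)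
  braid i hi hm := cs.braid_three (show cAffEntry g _ _ = 3 by
    rw [Fin.val_ofNat, Fin.val_ofNat, Nat.mod_eq_of_lt, Nat.mod_eq_of_lt]
    · unfold cAffEntry
      split_ifs <;> grind
    all_goals omega)
  braid_four hm := cs.braid_four (show cAffEntry g _ _ = 4 by
    rw [Fin.val_ofNat, Fin.val_ofNat, Nat.mod_eq_of_lt, Nat.mod_eq_of_lt]
    · unfold cAffEntry
      split_ifs <;> grind
    all_goals omega)

theorem isTypeCChain_simple_rev {m : ℕ} (hm : m ≤ g) :
    IsTypeCChain (fun i => cs.simple (Fin.ofNat (g + 1) (g - i))) m where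
  mul_self i _ := cs.simple_mul_simple_self _
  comm i j hij hj := (simple_comm_of_lt cs (by
    rw [Fin.val_ofNat, Fin.val_ofNat, Nat.mod_eq_of_lt, Nat.mod_eq_of_lt] <;> omega)).symm
  braid i hi hm := cs.braid_three (show cAffEntry g _ _ = 3 by
    rw [Fin.val_ofNat, Fin.val_ofNat, Nat.mod_eq_of_lt, Nat.mod_eq_of_lt]
    · unfold cAffEntry
      split_ifs <;> grind
    all_goals omega)
  braid_four hm := cs.braid_four (show cAffEntry g _ _ = 4 by
    rw [Fin.val_ofNat, Fin.val_ofNat, Nat.mod_eq_of_lt, Nat.mod_eq_of_lt]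
    · unfold cAffEntry
      split_ifs <;> grind
    all_goals omega)

theorem finite_closure_simple_lt {k : ℕ} (hk : k ≤ g) :
    (Subgroup.closure (cs.simple '' {j | (j : ℕ) < k}) : Set W).Finite := by
  refine (isTypeCChain_simple cs hk).finite_closure.subset (Subgroup.closure_mono ?_)
  rintro _ ⟨j, hj, rfl⟩
  exact ⟨j, hj, by simp⟩

theorem finite_closure_simple_gt (k : ℕ) :
    (Subgroup.closure (cs.simple '' {j | k < (j : ℕ)}) : Set W).Finite := by
  refine (isTypeCChain_simple_rev cs (Nat.sub_le g k)).finite_closure.subset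
    (Subgroup.closure_mono ?_)
  rintro _ ⟨j, hj, rfl⟩
  have hj' : k < (j : ℕ) := hj
  refine ⟨g - j, show g - (j : ℕ) < g - k by omega, ?_⟩
  simp [show g - (g - (j : ℕ)) = j by omega]

theorem finite_closure_simple_of_notMem {k : ℕ} (hk : k ≤ g) {K : Set (Fin (g + 1))}
    (hK : ∀ j ∈ K, (j : ℕ) ≠ k) : (Subgroup.closure (cs.simple '' K) : Set W).Finite := by
  refine (Subgroup.finite_sup_of_commute (finite_closure_simple_lt cs hk)
    (finite_closure_simple_gt cs k) fun a ha b hb =>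
      Subgroup.commute_of_mem_closure ?_ ha hb).subset ?_
  · rintro _ ⟨i, hi, rfl⟩ _ ⟨j, hj, rfl⟩
    have hi' : (i : ℕ) < k := hi
    have hj' : k < (j : ℕ) := hj
    exact simple_comm_of_lt cs (by omega)
  · rw [← Subgroup.closure_union, ← Set.image_union]
    exact Subgroup.closure_mono (Set.image_mono fun j hj => lt_or_gt_of_ne (hK j hj))

theorem exists_mem_cWAff (hg : 2 ≤ g) {w : W} (hw : w ∈ cWAff g cs g) :
    ∃ c ≤ g, w ∈ cWAff g cs c ∧ ∀ j : Fin (g + 1), g - c < (j : ℕ) → j ∈ supp cs w := by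
  obtain ⟨hmem, hmin⟩ := hw
  simp only [Nat.sub_self] at hmin
  have hsub := supp_subset_of_mem_closure cs hg hmem
  obtain ⟨ω, hω, rfl⟩ := cs.exists_isReduced w
  have hpos : ∀ j ∈ ω, 0 < (j : ℕ) := fun j hj => by
    simpa using hsub ⟨ω, hω, rfl, hj⟩
  obtain rfl | hne := eq_or_ne ω []
  · exact ⟨0, by omega, ⟨by simp, fun j _ _ => by omega⟩,
      fun j hj => by omega⟩
  obtain ⟨i, hi, hle⟩ := Finset.exists_min_image ω.toFinset id (by simpa using hne)
  simp only [List.mem_toFinset, id] at hi hle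
  have hup : ∀ n : ℕ, ∀ j : Fin (g + 1), (j : ℕ) = i + n → j ∈ ω := by
    intro n
    induction n with
    | zero => exact fun j hj => Fin.ext hj ▸ hi
    | succ n ih =>
      intro j hj
      obtain ⟨k, hk, hk'⟩ := exists_mem_eq_add_one cs hω hpos hmin
        (ih ⟨i + n, by omega⟩ rfl) (show (i : ℕ) + n < g by omega)
      rwa [show j = k from Fin.ext (by simp only at hk'; omega)]
  have hi₀ := hpos i hi
  refine ⟨g - i + 1, by omega, ⟨wordProd_mem_closure cs fun j hj => ?_,
    fun j hj hjg => hmin j (by omega) hjg⟩, fun j hj => ⟨ω, hω, rfl, hup (j - i) j (by omega)⟩⟩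
  have := hle j hj
  change g - (g - (i : ℕ) + 1) < (j : ℕ)
  omega

end Affine

/-- Criterion for basic Ekedahl–Oort strata: identify the finite Weyl group `W_g` of type
`C_g` with the standard parabolic subgroup of the type-`C̃_g` Coxeter system generated by
`{u_1, …, u_g}`, via `t_i ↦ u_i`.  Then for every `w ∈ ᵍW`, the standard parabolic
subgroup `W_{supp(w) ∪ ι(supp(w))}` of the affine Coxeter group (where `ι(u_i) = u_{g−i}`)
is finite if and only if `w ∈ ᶜW` for some integer `c` with `0 ≤ c ≤ g/2`. -/
theorem basic_EO_criterion (g : ℕ) (hg : 2 ≤ g) {W : Type*} [Group W]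
    (cs : CoxeterSystem (CAffMatrix g) W) (w : W) (hw : w ∈ cWAff g cs g) :
    Finite ↥(Subgroup.closure (cs.simple ''
        (supp cs w ∪
          (fun i : Fin (g + 1) => (⟨g - (i : ℕ), by omega⟩ : Fin (g + 1))) '' supp cs w))) ↔
      ∃ c : ℕ, 2 * c ≤ g ∧ w ∈ cWAff g cs c := by
  constructor
  · intro hfin
    obtain ⟨c, hcg, hc, hall⟩ := exists_mem_cWAff cs hg hw
    refine ⟨c, ?_, hc⟩
    by_contra! hlt
    have huniv : supp cs w ∪
        (fun i : Fin (g + 1) => (⟨g - (i : ℕ), by omega⟩ : Fin (g + 1))) '' supp cs w =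
          Set.univ := by
      refine Set.eq_univ_of_forall fun j => ?_
      by_cases hj : g - c < (j : ℕ)
      · exact .inl (hall j hj)
      · refine .inr ⟨⟨g - j, by omega⟩, hall _ (show g - c < g - (j : ℕ) by omega), Fin.ext ?_⟩
        change g - (g - (j : ℕ)) = j
        omega
    rw [huniv, Set.image_univ, cs.subgroup_closure_range_simple] at hfin
    have := infinite_of_coxeterSystem_CAffMatrix hg cs
    have := Finite.of_equiv _ (Subgroup.topEquiv (G := W)).toEquiv
    exact not_finite W
  · rintro ⟨c, hc, hwc⟩
    have hsub := supp_subset_of_mem_closure cs hg hwc.1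
    refine (finite_closure_simple_of_notMem cs (Nat.sub_le g c) ?_).to_subtype
    rintro _ (hj | ⟨j, hj, rfl⟩)
    · exact (hsub hj).ne'
    · have : g - c < (j : ℕ) := hsub hj
      change g - (j : ℕ) ≠ g - c
      omega
end
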